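/- There exists a universal constant C > 0 such that for every C*-algebra B and all a, b ∈ M₃(B), the commutator [a,b] = ab − ba is a sum of at most 14 square-zero elements of M₃(B), each of norm at most C·‖a‖·‖b‖. -/

import Mathlib

open Matrix

section RowPart

variable {B : Type*} {n : Type*} [DecidableEq n]

/-- The matrix that agrees with `X` on the `k`-th row and vanishes elsewhere. -/
def Matrix.rowPart [Zero B] (k : n) (X : Matrix n n B) : Matrix n n B :=
  Matrix.of fun i j => if i = k then X i j else 0

theorem Matrix.sum_rowPart [Fintype n] [AddCommMonoid B] (X : Matrix n n B) :
    ∑ k, X.rowPart k = X := by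
  ext i j
  simp [Matrix.sum_apply, Matrix.rowPart]

theorem Matrix.rowPart_mul_self [Fintype n] [NonUnitalNonAssocSemiring B] {k : n}
    {X : Matrix n n B} (h : X k k = 0) : X.rowPart k * X.rowPart k = 0 := by
  ext i j
  rw [Matrix.mul_apply, Matrix.zero_apply]
  refine Finset.sum_eq_zero fun l _ => ?_
  by_cases hl : l = k
  · subst hl
    by_cases hi : i = l <;> simp [Matrix.rowPart, hi, h]
  · simp [Matrix.rowPart, hl]

theorem Matrix.conjTranspose_rowPart_conjTranspose_rowPart [AddMonoid B] [StarAddMonoid B]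
    (i j : n) (X : Matrix n n B) : ((X.rowPart i)ᴴ.rowPart j)ᴴ = single i j (X i j) := by
  ext k l
  simp only [Matrix.rowPart, Matrix.single_apply, Matrix.conjTranspose_apply, Matrix.of_apply,
    eq_comm (a := i), eq_comm (a := j)]
  by_cases hk : k = i <;> by_cases hl : l = j <;> simp [hk, hl]

end RowPart

section CornerBlock

variable {B : Type*} {n : Type*} [DecidableEq n]

/-- The matrix with the `2 × 2` block `(p, q; r, s)` in the rows and columns `i`, `j`. -/
def Matrix.cornerBlock [AddZeroClass B] (i j : n) (p q r s : B) : Matrix n n B :=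
  single i i p + single i j q + single j i r + single j j s

theorem Matrix.cornerBlock_mul_self [Fintype n] [NonUnitalNonAssocSemiring B] {i j : n}
    (hij : i ≠ j) {p q r s : B} (h₁ : p * p + q * r = 0) (h₂ : p * q + q * s = 0)
    (h₃ : r * p + s * r = 0) (h₄ : r * q + s * s = 0) :
    cornerBlock i j p q r s * cornerBlock i j p q r s = 0 := by
  have key : cornerBlock i j p q r s * cornerBlock i j p q r s =
      cornerBlock i j (p * p + q * r) (p * q + q * s) (r * p + s * r) (r * q + s * s) := by
    simp only [cornerBlock, add_mul, mul_add, single_mul_single_same,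
      single_mul_single_of_ne _ _ _ _ hij, single_mul_single_of_ne _ _ _ _ hij.symm, single_add]
    abel
  rw [key, h₁, h₂, h₃, h₄]
  simp [cornerBlock]

theorem Matrix.cornerBlock_self_neg_mul_self [Fintype n] [NonUnitalRing B] {i j : n}
    (hij : i ≠ j) (x : B) : cornerBlock i j x x (-x) (-x) * cornerBlock i j x x (-x) (-x) = 0 := by
  apply cornerBlock_mul_self hij <;> simp

/-- A block with diagonal `(x * y, -(y * x))`, square-zero as soon as `c * d = 1`. -/
def Matrix.commutatorBlock [NonUnitalRing B] [Module ℂ B] (i j : n) (c d : ℂ) (x y : B) :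
    Matrix n n B :=
  cornerBlock i j (x * y) (-(d • (x * y * x))) (c • y) (-(y * x))

theorem Matrix.commutatorBlock_mul_self [Fintype n] [NonUnitalRing B] [Module ℂ B]
    [IsScalarTower ℂ B B] [SMulCommClass ℂ B B] {i j : n} (hij : i ≠ j) {c d : ℂ} (x y : B)
    (h : c * d = 1) : commutatorBlock i j c d x y * commutatorBlock i j c d x y = 0 := by
  have h' : d * c = 1 := by rw [mul_comm, h]
  apply cornerBlock_mul_self hij <;>
    simp [smul_mul_assoc, mul_smul_comm, smul_smul, mul_assoc, h, h']

end CornerBlock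

/-- A C*-norm, not assumed complete, on the square matrices over `B`. -/
structure IsMatrixCStarNorm {n B : Type*} [Fintype n] [NonUnitalCStarAlgebra B]
    (Nm : Matrix n n B → ℝ) : Prop where
  nonneg : ∀ X, 0 ≤ Nm X
  eq_zero_iff : ∀ X, Nm X = 0 ↔ X = 0
  add_le : ∀ X Y, Nm (X + Y) ≤ Nm X + Nm Y
  smul : ∀ (c : ℂ) (X), Nm (c • X) = ‖c‖ * Nm X
  mul_le : ∀ X Y, Nm (X * Y) ≤ Nm X * Nm Y
  conjTranspose_mul_self : ∀ X, Nm (Xᴴ * X) = Nm X * Nm X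

namespace IsMatrixCStarNorm

variable {n B : Type*} [Fintype n] [NonUnitalCStarAlgebra B] {Nm : Matrix n n B → ℝ}

theorem map_neg (h : IsMatrixCStarNorm Nm) (X : Matrix n n B) : Nm (-X) = Nm X := by
  simpa using h.smul (-1) X

theorem sub_le (h : IsMatrixCStarNorm Nm) (X Y : Matrix n n B) : Nm (X - Y) ≤ Nm X + Nm Y := by
  simpa [sub_eq_add_neg, h.map_neg] using h.add_le X (-Y)

theorem map_zero (h : IsMatrixCStarNorm Nm) : Nm 0 = 0 := (h.eq_zero_iff 0).2 rfl

theorem sum_le (h : IsMatrixCStarNorm Nm) {ι : Type*} (s : Finset ι) (f : ι → Matrix n n B) :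
    Nm (∑ i ∈ s, f i) ≤ ∑ i ∈ s, Nm (f i) :=
  Finset.le_sum_of_subadditive Nm h.map_zero.le h.add_le s f

theorem commutator_le (h : IsMatrixCStarNorm Nm) (X Y : Matrix n n B) :
    Nm (X * Y - Y * X) ≤ 2 * (Nm X * Nm Y) := by
  linarith [h.sub_le (X * Y) (Y * X), h.mul_le X Y, h.mul_le Y X]

theorem eq_of_conjTranspose_mul_self_eq (h : IsMatrixCStarNorm Nm) {X Y : Matrix n n B}
    (hXY : Xᴴ * X = Yᴴ * Y) : Nm X = Nm Y := by
  rw [← mul_self_inj (h.nonneg X) (h.nonneg Y), ← h.conjTranspose_mul_self, hXY,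
    h.conjTranspose_mul_self]

theorem map_conjTranspose (h : IsMatrixCStarNorm Nm) (X : Matrix n n B) : Nm Xᴴ = Nm X := by
  have key : ∀ Y, Nm Y ≤ Nm Yᴴ := fun Y => by
    rcases (h.nonneg Y).eq_or_lt with h0 | h0
    · exact h0 ▸ h.nonneg _
    · exact le_of_mul_le_mul_right (h.conjTranspose_mul_self Y ▸ h.mul_le _ _) h0
  exact le_antisymm (by simpa using key Xᴴ) (key X)

variable [DecidableEq n]

theorem rowPart_le (h : IsMatrixCStarNorm Nm) (k : n) (X : Matrix n n B) :
    Nm (X.rowPart k) ≤ Nm X := by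
  have hflip : Nm (X.rowPart k + X.rowPart k - X) = Nm X := by
    refine h.eq_of_conjTranspose_mul_self_eq ?_
    ext i j
    simp only [Matrix.mul_apply, Matrix.conjTranspose_apply]
    refine Finset.sum_congr rfl fun l _ => ?_
    by_cases hl : l = k <;> simp [Matrix.rowPart, hl]
  have hhalf : X.rowPart k = (1 / 2 : ℂ) • ((X.rowPart k + X.rowPart k - X) + X) := by
    rw [sub_add_cancel, ← two_smul ℂ, smul_smul]
    norm_num
  have hsum := h.add_le (X.rowPart k + X.rowPart k - X) X
  have hnorm : ‖(1 / 2 : ℂ)‖ = 1 / 2 := by norm_num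
  rw [hhalf, h.smul, hnorm]
  linarith

theorem single_apply_le (h : IsMatrixCStarNorm Nm) (i j : n) (X : Matrix n n B) :
    Nm (single i j (X i j)) ≤ Nm X := by
  rw [← Matrix.conjTranspose_rowPart_conjTranspose_rowPart, h.map_conjTranspose]
  exact (h.rowPart_le _ _).trans ((h.map_conjTranspose _).trans_le (h.rowPart_le _ _))

theorem single_eq (h : IsMatrixCStarNorm Nm) (i j k l : n) (x : B) :
    Nm (single i j x) = Nm (single k l x) := by
  have hrow : ∀ (i k j : n) (x : B), Nm (single i j x) = Nm (single k j x) := fun i k j x =>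
    h.eq_of_conjTranspose_mul_self_eq (by simp)
  have hstar : ∀ (i j : n) (x : B), Nm (single i j x) = Nm (single j i (star x)) := fun i j x => by
    rw [← h.map_conjTranspose, conjTranspose_single]
  rw [hrow i k, hstar, hrow j l, ← hstar]

theorem single_neg_eq (h : IsMatrixCStarNorm Nm) (i j : n) (x : B) :
    Nm (single i j (-x)) = Nm (single i j x) := by
  rw [← Matrix.single_neg, h.map_neg]

theorem single_mul_le (h : IsMatrixCStarNorm Nm) (i j : n) (x y : B) :
    Nm (single i j (x * y)) ≤ Nm (single i j x) * Nm (single i j y) := by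
  have hmul := h.mul_le (single i j x) (single j j y)
  rwa [single_mul_single_same, h.single_eq j j i j] at hmul

theorem cornerBlock_le (h : IsMatrixCStarNorm Nm) (i j k l : n) (p q r s : B) :
    Nm (cornerBlock i j p q r s) ≤ Nm (single k l p) + Nm (single k l q) + Nm (single k l r) +
      Nm (single k l s) := by
  rw [← h.single_eq i i k l p, ← h.single_eq i j k l q, ← h.single_eq j i k l r,
    ← h.single_eq j j k l s]
  have h₁ := h.add_le (single i i p + single i j q + single j i r) (single j j s)
  have h₂ := h.add_le (single i i p + single i j q) (single j i r)
  have h₃ := h.add_le (single i i p) (single i j q)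
  rw [cornerBlock]
  linarith

theorem cornerBlock_self_neg_le (h : IsMatrixCStarNorm Nm) (i j k : n) (X : Matrix n n B) :
    Nm (cornerBlock i j (X k k) (X k k) (-X k k) (-X k k)) ≤ 4 * Nm X := by
  have hneg : Nm (single k k (-X k k)) = Nm (single k k (X k k)) :=
    h.single_neg_eq k k _
  have hblock := h.cornerBlock_le i j k k (X k k) (X k k) (-X k k) (-X k k)
  rw [hneg] at hblock
  linarith [h.single_apply_le k k X]

/-- Up to a trace-zero matrix, a commutator in `B` is a square-zero matrix of controlled norm. -/
theorem exists_commutatorBlock (h : IsMatrixCStarNorm Nm) {i j : n} (hij : i ≠ j) (x y : B) :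
    ∃ c d : ℂ, commutatorBlock i j c d x y * commutatorBlock i j c d x y = 0 ∧
      Nm (commutatorBlock i j c d x y) ≤ 4 * (Nm (single i j x) * Nm (single i j y)) := by
  set N : B → ℝ := fun x => Nm (single i j x) with hN
  have hN0 : ∀ x, 0 ≤ N x := fun x => h.nonneg _
  have hNneg : ∀ x, N (-x) = N x := h.single_neg_eq i j
  have hNsmul : ∀ (c : ℂ) x, N (c • x) = ‖c‖ * N x := fun c x => by
    simp only [hN, ← smul_single, h.smul]
  have hNmul : ∀ x y, N (x * y) ≤ N x * N y := h.single_mul_le i j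
  rcases (hN0 x).eq_or_lt with hx | hx
  · obtain rfl : x = 0 := by
      simpa using congrFun (congrFun ((h.eq_zero_iff _).1 hx.symm) i) j
    refine ⟨0, 0, ?_, ?_⟩
    · simp [commutatorBlock, cornerBlock]
    · simp [commutatorBlock, cornerBlock, h.map_zero]
  · refine ⟨(N x : ℂ), ((N x)⁻¹ : ℂ), commutatorBlock_mul_self hij x y ?_, ?_⟩
    · exact mul_inv_cancel₀ (by exact_mod_cast hx.ne')
    · have hxyx : N (((N x)⁻¹ : ℂ) • (x * y * x)) ≤ N x * N y := by
        have hle : N (x * y * x) ≤ N x * (N x * N y) :=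
          (hNmul _ _).trans ((mul_le_mul_of_nonneg_right (hNmul x y) hx.le).trans_eq (mul_comm _ _))
        rw [hNsmul, norm_inv, Complex.norm_real, Real.norm_of_nonneg hx.le, inv_mul_le_iff₀ hx]
        exact hle
      have hy : N ((N x : ℂ) • y) = N x * N y := by
        rw [hNsmul, Complex.norm_real, Real.norm_of_nonneg hx.le]
      have hblock : Nm (commutatorBlock i j (N x : ℂ) ((N x)⁻¹ : ℂ) x y) ≤ N (x * y) +
          N (-(((N x)⁻¹ : ℂ) • (x * y * x))) + N ((N x : ℂ) • y) + N (-(y * x)) :=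
        h.cornerBlock_le i j i j _ _ _ _
      rw [hNneg, hNneg, hy] at hblock
      have hyx := hNmul y x
      rw [mul_comm (N y)] at hyx
      linarith [hNmul x y]

end IsMatrixCStarNorm

/-- A trace-zero `3 × 3` matrix is a sum of five square-zero matrices of controlled norm. -/
theorem IsMatrixCStarNorm.exists_sum_of_trace_eq_zero {B : Type*} [NonUnitalCStarAlgebra B]
    {Nm : Matrix (Fin 3) (Fin 3) B → ℝ} (h : IsMatrixCStarNorm Nm)
    {D : Matrix (Fin 3) (Fin 3) B} (hD : D.trace = 0) :
    ∃ z : Fin 2 ⊕ Fin 3 → Matrix (Fin 3) (Fin 3) B,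
      D = ∑ i, z i ∧ ∀ i, z i * z i = 0 ∧ Nm (z i) ≤ 9 * Nm D := by
  set S := cornerBlock (0 : Fin 3) 1 (D 0 0) (D 0 0) (-D 0 0) (-D 0 0) with hS
  set T := cornerBlock (2 : Fin 3) 1 (D 2 2) (D 2 2) (-D 2 2) (-D 2 2) with hT
  have hdiag : ∀ k, (D - (S + T)) k k = 0 := by
    have h₁ : D 1 1 = -D 0 0 - D 2 2 := by
      rw [Matrix.trace_fin_three] at hD
      rw [← sub_eq_zero, ← hD]
      abel
    intro k
    fin_cases k <;> simp [hS, hT, cornerBlock, h₁, sub_eq_add_neg, add_comm]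
  have hNS : Nm S ≤ 4 * Nm D := h.cornerBlock_self_neg_le 0 1 0 D
  have hNT : Nm T ≤ 4 * Nm D := h.cornerBlock_self_neg_le 2 1 2 D
  have hND := h.nonneg D
  refine ⟨Sum.elim ![S, T] fun k => (D - (S + T)).rowPart k, ?_, ?_⟩
  · simp [Fintype.sum_sum_type, Matrix.sum_rowPart]
  · rintro (i | k)
    · fin_cases i
      · exact ⟨cornerBlock_self_neg_mul_self (by decide) _, hNS.trans (by linarith)⟩
      · exact ⟨cornerBlock_self_neg_mul_self (by decide) _, hNT.trans (by linarith)⟩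
    · refine ⟨rowPart_mul_self (hdiag k), (h.rowPart_le _ _).trans ?_⟩
      linarith [h.sub_le D (S + T), h.add_le S T]

theorem Matrix.trace_commutatorBlock {B : Type*} [NonUnitalRing B] [Module ℂ B] {n : Type*}
    [Fintype n] [DecidableEq n] {i j : n} (hij : i ≠ j) (c d : ℂ) (x y : B) :
    (commutatorBlock i j c d x y).trace = x * y - y * x := by
  simp [commutatorBlock, cornerBlock, trace_single_eq_of_ne _ _ _ hij,
    trace_single_eq_of_ne _ _ _ hij.symm, sub_eq_add_neg]

theorem Matrix.trace_mul_sub_mul {B : Type*} [NonUnitalNonAssocRing B] {n : Type*} [Fintype n]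
    (a b : Matrix n n B) :
    (a * b - b * a).trace = ∑ p : n × n, (a p.1 p.2 * b p.2 p.1 - b p.2 p.1 * a p.1 p.2) := by
  rw [Matrix.trace_sub, Finset.sum_sub_distrib, Fintype.sum_prod_type, Fintype.sum_prod_type_right]
  simp [Matrix.trace, Matrix.mul_apply]


/-- There is a universal constant `C > 0` such that in `M₃(B)`,
for any C*-algebra `B`, every commutator `[a, b]` is a sum of (at most) 14 square-zero
elements, each of norm at most `C·‖a‖·‖b‖`.  The (unique) C*-norm on `M₃(B)` is
represented by a function `Nm` satisfying the C*-norm axioms. -/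
theorem statement13 :
    ∃ C : ℝ, 0 < C ∧
      ∀ (B : Type*) [inst : NonUnitalCStarAlgebra B]
        (Nm : Matrix (Fin 3) (Fin 3) B → ℝ),
        (∀ X, 0 ≤ Nm X) →
        (∀ X, Nm X = 0 ↔ X = 0) →
        (∀ X Y, Nm (X + Y) ≤ Nm X + Nm Y) →
        (∀ (c : ℂ) (X), Nm (c • X) = ‖c‖ * Nm X) →
        (∀ X Y, Nm (X * Y) ≤ Nm X * Nm Y) →
        (∀ X, Nm (X.conjTranspose * X) = Nm X * Nm X) →
        ∀ a b : Matrix (Fin 3) (Fin 3) B,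
          ∃ z : Fin 14 → Matrix (Fin 3) (Fin 3) B,
            a * b - b * a = ∑ i, z i ∧
            ∀ i, z i * z i = 0 ∧ Nm (z i) ≤ C * Nm a * Nm b := by
  refine ⟨342, by norm_num, ?_⟩
  intro B _ Nm h₁ h₂ h₃ h₄ h₅ h₆ a b
  have h : IsMatrixCStarNorm Nm := ⟨h₁, h₂, h₃, h₄, h₅, h₆⟩
  have h01 : (0 : Fin 3) ≠ 1 := by decide
  have hP : 0 ≤ Nm a * Nm b := mul_nonneg (h₁ a) (h₁ b)
  choose c d hsq hle using fun p : Fin 3 × Fin 3 =>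
    h.exists_commutatorBlock h01 (a p.1 p.2) (b p.2 p.1)
  set Z : Fin 3 × Fin 3 → Matrix (Fin 3) (Fin 3) B := fun p =>
    commutatorBlock 0 1 (c p) (d p) (a p.1 p.2) (b p.2 p.1) with hZ
  have hNZ : ∀ p, Nm (Z p) ≤ 4 * (Nm a * Nm b) := fun p => by
    have ha := h.single_apply_le p.1 p.2 a
    have hb := h.single_apply_le p.2 p.1 b
    rw [h.single_eq _ _ 0 1] at ha hb
    exact (hle p).trans
      (mul_le_mul_of_nonneg_left (mul_le_mul ha hb (h₁ _) (h₁ _)) (by norm_num))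
  have htrace : (a * b - b * a - ∑ p, Z p).trace = 0 := by
    rw [Matrix.trace_sub, Matrix.trace_mul_sub_mul, Matrix.trace_sum, sub_eq_zero]
    exact Finset.sum_congr rfl fun p _ => (Matrix.trace_commutatorBlock h01 _ _ _ _).symm
  have hND : Nm (a * b - b * a - ∑ p, Z p) ≤ 38 * (Nm a * Nm b) := by
    have hsum : Nm (∑ p, Z p) ≤ 36 * (Nm a * Nm b) := by
      refine (h.sum_le _ _).trans ((Finset.sum_le_sum fun p _ => hNZ p).trans_eq ?_)
      simp
      ring
    linarith [h.sub_le (a * b - b * a) (∑ p, Z p), h.commutator_le a b]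
  obtain ⟨w, hw, hw'⟩ := h.exists_sum_of_trace_eq_zero htrace
  let e : Fin 14 ≃ (Fin 3 × Fin 3) ⊕ (Fin 2 ⊕ Fin 3) :=
    (Fintype.equivFinOfCardEq (by simp)).symm
  refine ⟨fun i => Sum.elim Z w (e i), ?_, fun i => ?_⟩
  · rw [Equiv.sum_comp e (Sum.elim Z w), Fintype.sum_sum_type]
    simp only [Sum.elim_inl, Sum.elim_inr]
    rw [← hw, add_sub_cancel]
  · dsimp only
    rw [mul_assoc]
    rcases e i with p | k
    · exact ⟨hsq p, (hNZ p).trans (by linarith)⟩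
    · exact ⟨(hw' k).1, (hw' k).2.trans (by linarith)⟩
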